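/- Let M ≥ 1, let Q ∈ ℂ^{(M+1)×(M+1)} be a positive semidefinite Hermitian matrix, and let V ∈ ℂ^{(M+1)×M} be a matrix with orthonormal columns (VᴴV = I_M) such that VᴴQV = 0. Then rank(Q) ≤ 1. -/

import Mathlib

open Matrix ComplexOrder

open scoped MatrixOrder Matrix.Norms.L2Operator in
/-- A positive semidefinite matrix whose compression to the columns of `V` vanishes
annihilates those columns. -/
theorem Matrix.PosSemidef.mul_eq_zero_of_conjTranspose_mul_mul_same_eq_zero
    {n m : Type*} [Fintype n] [Fintype m]
    {Q : Matrix n n ℂ} (hQ : Q.PosSemidef) {V : Matrix n m ℂ} (h0 : Vᴴ * Q * V = 0) :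
    Q * V = 0 := by
  classical
  obtain ⟨B, rfl⟩ := CStarAlgebra.nonneg_iff_eq_star_mul_self.mp hQ.nonneg
  rw [star_eq_conjTranspose] at h0 ⊢
  have hBV : B * V = 0 := by
    rw [← conjTranspose_mul_self_eq_zero, conjTranspose_mul]
    simpa only [Matrix.mul_assoc] using h0
  rw [Matrix.mul_assoc, hBV, Matrix.mul_zero]

/-- if `Q ∈ ℂ^{(M+1)×(M+1)}` is positive semidefinite and
`V ∈ ℂ^{(M+1)×M}` has orthonormal columns with `VᴴQV = 0`, then `rank Q ≤ 1`. -/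
theorem stmt_6 (M : ℕ) (hM : 1 ≤ M)
    (Q : Matrix (Fin (M + 1)) (Fin (M + 1)) ℂ) (hQ : Q.PosSemidef)
    (V : Matrix (Fin (M + 1)) (Fin M) ℂ) (hV : Vᴴ * V = 1)
    (h0 : Vᴴ * Q * V = 0) :
    Q.rank ≤ 1 := by
  have hrank := rank_add_rank_le_card_of_mul_eq_zero
    (hQ.mul_eq_zero_of_conjTranspose_mul_mul_same_eq_zero h0)
  have hVrank : V.rank = M := by
    rw [← rank_conjTranspose_mul_self, hV, rank_one, Fintype.card_fin]
  rw [hVrank, Fintype.card_fin] at hrank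
  lia
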